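/- For every positive integer s, the complete bipartite graph K_{2,s} admits an axis-aligned 2-bend EPG representation. -/

import Mathlib

open Set

/-- Two points span an axis-parallel segment (same x or same y). -/
def AxisParallel (p q : ℝ × ℝ) : Prop := p.1 = q.1 ∨ p.2 = q.2

/-- Segment `p q` and segment `q r` are axis-parallel and mutually perpendicular. -/
def Perp (p q r : ℝ × ℝ) : Prop :=
  (p.1 = q.1 ∧ q.2 = r.2) ∨ (p.2 = q.2 ∧ q.1 = r.1)

/-- An axis-aligned 2-bend path: a union of at most three closed segments of positive
length, each axis-parallel, consecutive ones sharing an endpoint and perpendicular. -/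
def IsAA2BendPath (P : Set (ℝ × ℝ)) : Prop :=
  (∃ p q : ℝ × ℝ, p ≠ q ∧ AxisParallel p q ∧ P = segment ℝ p q) ∨
  (∃ p q r : ℝ × ℝ, p ≠ q ∧ q ≠ r ∧ Perp p q r ∧
    P = segment ℝ p q ∪ segment ℝ q r) ∨
  (∃ p q r s : ℝ × ℝ, p ≠ q ∧ q ≠ r ∧ r ≠ s ∧ Perp p q r ∧ Perp q r s ∧
    P = segment ℝ p q ∪ segment ℝ q r ∪ segment ℝ r s)

/-- An axis-aligned 2-bend EPG representation of a graph. -/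
def IsAA2BendEPG {V : Type*} (G : SimpleGraph V) (f : V → Set (ℝ × ℝ)) : Prop :=
  (∀ v, IsAA2BendPath (f v)) ∧
  ∀ u v : V, u ≠ v → (G.Adj u v ↔ (f u ∩ f v).Infinite)

/-- A maximal clique of a graph. -/
def MaximalClique {V : Type*} (G : SimpleGraph V) (s : Set V) : Prop :=
  G.IsClique s ∧ ∀ t : Set V, G.IsClique t → s ⊆ t → t = s


lemma mem_hseg {a b c : ℝ} (h : a ≤ b) (p : ℝ × ℝ) :
    p ∈ segment ℝ (a, c) (b, c) ↔ a ≤ p.1 ∧ p.1 ≤ b ∧ p.2 = c := by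
  rw [← Prod.image_mk_segment_left, segment_eq_Icc h]
  obtain ⟨x, y⟩ := p
  simp only [mem_image, mem_Icc, Prod.mk.injEq]
  constructor
  · rintro ⟨t, ⟨h1, h2⟩, rfl, rfl⟩
    exact ⟨h1, h2, rfl⟩
  · rintro ⟨h1, h2, rfl⟩
    exact ⟨x, ⟨h1, h2⟩, rfl, rfl⟩

lemma mem_vseg {a b c : ℝ} (h : a ≤ b) (p : ℝ × ℝ) :
    p ∈ segment ℝ (c, a) (c, b) ↔ a ≤ p.2 ∧ p.2 ≤ b ∧ p.1 = c := by
  rw [← Prod.image_mk_segment_right, segment_eq_Icc h]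
  obtain ⟨x, y⟩ := p
  simp only [mem_image, mem_Icc, Prod.mk.injEq]
  constructor
  · rintro ⟨t, ⟨h1, h2⟩, rfl, rfl⟩
    exact ⟨h1, h2, rfl⟩
  · rintro ⟨h1, h2, rfl⟩
    exact ⟨y, ⟨h1, h2⟩, rfl, rfl⟩

lemma hseg_infinite {a b c : ℝ} (h : a < b) : (segment ℝ (a, c) (b, c)).Infinite := by
  rw [← Prod.image_mk_segment_left, segment_eq_Icc h.le]
  exact (Icc_infinite h).image (fun x _ y _ hxy => (Prod.mk.inj hxy).1)

/-- The long horizontal segment at height `c`. -/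
def rowPath (L c : ℝ) : Set (ℝ × ℝ) := segment ℝ (0, c) (L, c)

/-- The Z-shaped path starting at abscissa `a`, joining heights 0 and 1. -/
def zPath (a : ℝ) : Set (ℝ × ℝ) :=
  segment ℝ (a, 0) (a + 1, 0) ∪ segment ℝ (a + 1, 0) (a + 1, 1) ∪
    segment ℝ (a + 1, 1) (a + 2, 1)

lemma zPath_bounds {a : ℝ} {p : ℝ × ℝ} (hp : p ∈ zPath a) : a ≤ p.1 ∧ p.1 ≤ a + 2 := by
  rcases hp with (hp | hp) | hp
  · rw [mem_hseg (by linarith)] at hp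
    constructor <;> linarith [hp.1, hp.2.1]
  · rw [mem_vseg (by norm_num)] at hp
    constructor <;> linarith [hp.2.2]
  · rw [mem_hseg (by linarith)] at hp
    constructor <;> linarith [hp.1, hp.2.1]

lemma row_inter_z {L a : ℝ} (k : Fin 2) (h0 : 0 ≤ a) (hL : a + 2 ≤ L) :
    (rowPath L (k : ℕ) ∩ zPath a).Infinite := by
  fin_cases k
  · refine (hseg_infinite (a := a) (b := a + 1) (c := 0) (by linarith)).mono ?_
    intro p hp
    refine ⟨?_, Or.inl (Or.inl hp)⟩
    rw [mem_hseg (by linarith)] at hp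
    rw [rowPath, mem_hseg (by linarith)]
    exact ⟨by linarith [hp.1], by linarith [hp.2.1], by simpa using hp.2.2⟩
  · refine (hseg_infinite (a := a + 1) (b := a + 2) (c := 1) (by linarith)).mono ?_
    intro p hp
    refine ⟨?_, Or.inr hp⟩
    rw [mem_hseg (by linarith)] at hp
    rw [rowPath, mem_hseg (by linarith)]
    exact ⟨by linarith [hp.1], by linarith [hp.2.1], by simpa using hp.2.2⟩

lemma z_inter_z {i j : ℕ} (h : i < j) : zPath (3 * i) ∩ zPath (3 * j) = ∅ := by
  ext p
  simp only [mem_inter_iff, mem_empty_iff_false, iff_false, not_and]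
  intro h1 h2
  have h1 := zPath_bounds h1
  have h2 := zPath_bounds h2
  have : (i : ℝ) + 1 ≤ j := by exact_mod_cast h
  linarith [h1.2, h2.1]

/-- For every positive integer `s`, the complete bipartite graph `K_{2,s}` admits an
axis-aligned 2-bend EPG representation. -/
theorem stmt11 (s : ℕ) (hs : 0 < s) :
    ∃ f : Fin 2 ⊕ Fin s → Set (ℝ × ℝ),
      IsAA2BendEPG (completeBipartiteGraph (Fin 2) (Fin s)) f := by
  have hs' : (0 : ℝ) < 3 * s := by positivity
  have key : ∀ (k : Fin 2) (i : Fin s),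
      (rowPath (3 * s) (k : ℕ) ∩ zPath (3 * (i : ℕ))).Infinite := by
    intro k i
    have : ((i : ℕ) : ℝ) + 1 ≤ s := by exact_mod_cast i.2
    exact row_inter_z k (by positivity) (by linarith)
  refine ⟨Sum.elim (fun k => rowPath (3 * s) (k : ℕ)) (fun i => zPath (3 * (i : ℕ))), ?_, ?_⟩
  · rintro (k | i)
    · refine Or.inl ⟨(0, ((k : ℕ) : ℝ)), (3 * (s : ℝ), ((k : ℕ) : ℝ)), ?_, Or.inr rfl, rfl⟩
      intro h
      exact hs'.ne (Prod.mk.inj h).1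
    · refine Or.inr (Or.inr ⟨(3 * ((i : ℕ) : ℝ), 0), (3 * ((i : ℕ) : ℝ) + 1, 0),
        (3 * ((i : ℕ) : ℝ) + 1, 1), (3 * ((i : ℕ) : ℝ) + 2, 1), ?_, ?_, ?_, Or.inr ⟨rfl, rfl⟩, Or.inl ⟨rfl, rfl⟩, rfl⟩)
      · intro h
        linarith [(Prod.mk.inj h).1]
      · intro h
        linarith [(Prod.mk.inj h).2]
      · intro h
        linarith [(Prod.mk.inj h).1]
  · rintro (k | i) (l | j) huv
    · refine iff_of_false (by simp) ?_
      have hkl : (k : ℕ) ≠ l := fun h => huv (congrArg _ (Fin.ext h))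
      have : rowPath (3 * s) (k : ℕ) ∩ rowPath (3 * s) (l : ℕ) = ∅ := by
        ext p
        simp only [mem_inter_iff, mem_empty_iff_false, iff_false, not_and]
        intro h1 h2
        rw [rowPath, mem_hseg hs'.le] at h1 h2
        exact hkl (by exact_mod_cast h1.2.2.symm.trans h2.2.2)
      simp [this]
    · exact iff_of_true (by simp) (key k j)
    · refine iff_of_true (by simp) ?_
      rw [inter_comm]
      exact key l i
    · refine iff_of_false (by simp) ?_
      have hij : (i : ℕ) ≠ j := fun h => huv (congrArg _ (Fin.ext h))
      rcases lt_or_gt_of_ne hij with h | h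
      · simp [z_inter_z h]
      · rw [inter_comm]
        simp [z_inter_z h]
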